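/- Let (A,D) be a pseudo-Cartan inclusion of C*-algebras. Then the map J ↦ J ∩ D is an inclusion-preserving bijection from the set of regular ideals of A onto the set of invariant regular ideals of D, whose inverse is K ↦ K^{⊥⊥} (annihilators computed in A). -/

import Mathlib

section Defs

variable {A : Type*} [NonUnitalCStarAlgebra A] [PartialOrder A] [StarOrderedRing A]

/-- `n` is a normalizer of `B` in `A`: `n B n* ⊆ B` and `n* B n ⊆ B`. -/
def IsNormalizer (B : Set A) (n : A) : Prop :=
  (∀ b ∈ B, n * b * star n ∈ B) ∧ (∀ b ∈ B, star n * b * n ∈ B)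

/-- `(A, B)` is an inclusion of C*-algebras: `B` is a closed *-subalgebra of `A`
containing an approximate unit for `A`. -/
structure IsInclusion (B : Set A) : Prop where
  zero_mem : (0 : A) ∈ B
  add_mem : ∀ x ∈ B, ∀ y ∈ B, x + y ∈ B
  smul_mem : ∀ (c : ℂ), ∀ x ∈ B, c • x ∈ B
  mul_mem : ∀ x ∈ B, ∀ y ∈ B, x * y ∈ B
  star_mem : ∀ x ∈ B, star x ∈ B
  isClosed : IsClosed B
  approxUnit : ∀ (s : Finset A), ∀ ε : ℝ, 0 < ε →
    ∃ e ∈ B, 0 ≤ e ∧ ‖e‖ ≤ 1 ∧ ∀ a ∈ s, ‖e * a - a‖ < ε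

/-- A regular inclusion: an inclusion whose normalizers span a dense subspace of `A`. -/
def IsRegularInclusion (B : Set A) : Prop :=
  IsInclusion B ∧ Dense (↑(Submodule.span ℂ {n : A | IsNormalizer B n}) : Set A)

/-- `J` is a closed two-sided ideal of the C*-subalgebra `C`. -/
structure IsClosedIdealOf (C J : Set A) : Prop where
  subset : J ⊆ C
  zero_mem : (0 : A) ∈ J
  add_mem : ∀ x ∈ J, ∀ y ∈ J, x + y ∈ J
  smul_mem : ∀ (c : ℂ), ∀ x ∈ J, c • x ∈ J
  mul_left : ∀ c ∈ C, ∀ x ∈ J, c * x ∈ J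
  mul_right : ∀ x ∈ J, ∀ c ∈ C, x * c ∈ J
  isClosed : IsClosed J

/-- The annihilator `X^{⊥}` of `X`, computed inside `C`. -/
def Ann (C X : Set A) : Set A :=
  {c ∈ C | ∀ x ∈ X, c * x = 0 ∧ x * c = 0}

/-- `J` is a regular ideal of `C`: a closed two-sided ideal with `J = J^{⊥⊥}` in `C`. -/
def IsRegularIdealOf (C J : Set A) : Prop :=
  IsClosedIdealOf C J ∧ Ann C (Ann C J) = J

/-- The inclusion `(C, B)` has the ideal intersection property: every nonzero closed
two-sided ideal of `C` meets `B` nontrivially. -/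
def IdealIntersectionProperty (C B : Set A) : Prop :=
  ∀ J : Set A, IsClosedIdealOf C J → (∃ x ∈ J, x ≠ 0) → ∃ x ∈ J ∩ B, x ≠ 0

/-- The relative commutant of `D` in `A`. -/
def RelComm (D : Set A) : Set A := {a : A | ∀ d ∈ D, a * d = d * a}

/-- `(A, D)` is a pseudo-Cartan inclusion. -/
structure IsPseudoCartan (D : Set A) : Prop where
  inclusion : IsInclusion D
  regular : Dense (↑(Submodule.span ℂ {n : A | IsNormalizer D n}) : Set A)
  abelian : ∀ x ∈ D, ∀ y ∈ D, x * y = y * x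
  relCommAbelian : ∀ x ∈ RelComm D, ∀ y ∈ RelComm D, x * y = y * x
  iip_relComm : IdealIntersectionProperty (RelComm D) D
  iip_A : IdealIntersectionProperty (Set.univ : Set A) (RelComm D)

/-- `K` is an invariant ideal of `D`: `n K n* ⊆ K` for every normalizer `n`. -/
def IsInvariantIdeal (D K : Set A) : Prop :=
  ∀ n : A, IsNormalizer D n → ∀ x ∈ K, n * x * star n ∈ K

/-- `K` is an invariant regular ideal of `D`. -/
def IsInvariantRegularIdeal (D K : Set A) : Prop :=
  IsRegularIdealOf D K ∧ IsInvariantIdeal D K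

/-- The image set `x B y = {x * b * y : b ∈ B}`. -/
def twoSidedImage (x y : A) (B : Set A) : Set A := (fun b => x * b * y) '' B

end Defs

section Helpers

variable {A : Type*} [NonUnitalCStarAlgebra A] [PartialOrder A] [StarOrderedRing A]

/-- Annihilators are closed. -/
theorem ann_isClosed (X : Set A) : IsClosed (Ann Set.univ X) := by
  have : Ann Set.univ X = ⋂ x ∈ X, ({c : A | c * x = 0} ∩ {c : A | x * c = 0}) := by
    ext c; simp [Ann]
  rw [this]
  refine isClosed_biInter fun x _ => IsClosed.inter ?_ ?_
  · exact isClosed_eq (by fun_prop) (by fun_prop)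
  · exact isClosed_eq (by fun_prop) (by fun_prop)

theorem mem_ann_univ {X : Set A} {c : A} :
    c ∈ Ann Set.univ X ↔ ∀ x ∈ X, c * x = 0 ∧ x * c = 0 := by simp [Ann]

/-- The annihilator is a closed ideal once the sandwiched products vanish. -/
theorem ann_isClosedIdeal {X : Set A}
    (h : ∀ a ∈ Ann Set.univ X, ∀ b : A, ∀ x ∈ X, x * b * a = 0 ∧ a * b * x = 0) :
    IsClosedIdealOf Set.univ (Ann Set.univ X) where
  subset := Set.subset_univ _
  zero_mem := by simp [mem_ann_univ]
  add_mem a ha b hb := by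
    rw [mem_ann_univ] at *
    intro x hx
    simp [add_mul, mul_add, ha x hx, hb x hx]
  smul_mem c a ha := by
    rw [mem_ann_univ] at *
    intro x hx
    simp [smul_mul_assoc, mul_smul_comm, ha x hx]
  mul_left b _ a ha := by
    have h1 := mem_ann_univ.1 ha
    rw [mem_ann_univ]
    intro x hx
    exact ⟨by rw [mul_assoc, (h1 x hx).1, mul_zero], by rw [← mul_assoc, (h a ha b x hx).1]⟩
  mul_right a ha b _ := by
    have h1 := mem_ann_univ.1 ha
    rw [mem_ann_univ]
    intro x hx
    exact ⟨(h a ha b x hx).2, by rw [← mul_assoc, (h1 x hx).2, zero_mul]⟩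
  isClosed := ann_isClosed X

theorem ann_ideal {I : Set A} (hI : IsClosedIdealOf Set.univ I) :
    IsClosedIdealOf Set.univ (Ann Set.univ I) :=
  ann_isClosedIdeal fun a ha b x hx =>
    ⟨((mem_ann_univ.1 ha) _ (hI.mul_right x hx b trivial)).2, by
      rw [mul_assoc]; exact ((mem_ann_univ.1 ha) _ (hI.mul_left b trivial x hx)).1⟩

theorem normalizer_star {D : Set A} {n : A} (hn : IsNormalizer D n) :
    IsNormalizer D (star n) := by
  refine ⟨fun b hb => ?_, fun b hb => ?_⟩
  · simpa using hn.2 b hb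
  · simpa using hn.1 b hb

/-- The annihilator in `A` of an invariant ideal of `D` is an ideal of `A`. -/
theorem ann_invariant {D K : Set A} (hD : IsPseudoCartan D) (hK : IsClosedIdealOf D K)
    (hinv : IsInvariantIdeal D K) : IsClosedIdealOf Set.univ (Ann Set.univ K) := by
  refine ann_isClosedIdeal fun a ha b x hx => ?_
  have h1 := mem_ann_univ.1 ha
  have hxs := hD.inclusion.star_mem x (hK.subset hx)
  have key : ∀ n, IsNormalizer D n → x * n * a = 0 ∧ a * n * x = 0 := by
    intro n hn
    constructor
    · rw [← CStarRing.star_mul_self_eq_zero_iff]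
      have := hinv _ (normalizer_star hn) _ (hK.mul_left _ hxs x hx)
      rw [star_star] at this
      have h2 := (h1 _ this).2
      calc star (x * n * a) * (x * n * a)
          = star a * (star n * (star x * x) * n * a) := by
            simp only [star_mul, mul_assoc]
        _ = 0 := by rw [h2, mul_zero]
    · rw [← CStarRing.mul_star_self_eq_zero_iff]
      have := hinv _ hn _ (hK.mul_right x hx _ hxs)
      have h2 := (h1 _ this).1
      calc a * n * x * star (a * n * x)
          = a * (n * (x * star x) * star n) * star a := by
            simp only [star_mul, mul_assoc]
        _ = 0 := by rw [h2, zero_mul]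
  have hcl : IsClosed {b : A | x * b * a = 0 ∧ a * b * x = 0} :=
    IsClosed.inter (isClosed_eq (f := fun b : A => x * b * a) (by fun_prop) (by fun_prop))
      (isClosed_eq (f := fun b : A => a * b * x) (by fun_prop) (by fun_prop))
  have hsub : (↑(Submodule.span ℂ {n : A | IsNormalizer D n}) : Set A) ⊆
      {b : A | x * b * a = 0 ∧ a * b * x = 0} := by
    intro b hb
    induction hb using Submodule.span_induction with
    | mem n hn => exact key n hn
    | zero => simp
    | add u v _ _ hu hv =>
      have hu' : x * u * a = 0 ∧ a * u * x = 0 := hu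
      have hv' : x * v * a = 0 ∧ a * v * x = 0 := hv
      simp [mul_add, add_mul, hu', hv']
    | smul c u _ hu =>
      have hu' : x * u * a = 0 ∧ a * u * x = 0 := hu
      simp [mul_smul_comm, smul_mul_assoc, hu']
  exact hcl.closure_subset_iff.2 hsub (hD.regular b)

theorem relComm_isClosed (D : Set A) : IsClosed (RelComm D) := by
  have : RelComm D = ⋂ d ∈ D, {a : A | a * d = d * a} := by
    ext c; simp [RelComm]
  rw [this]
  exact isClosed_biInter fun d _ => isClosed_eq (by fun_prop) (by fun_prop)

theorem relComm_mul {D : Set A} {x y : A} (hx : x ∈ RelComm D) (hy : y ∈ RelComm D) :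
    x * y ∈ RelComm D := by
  intro d hd
  rw [mul_assoc, hy d hd, ← mul_assoc, hx d hd, mul_assoc]

/-- A pseudo-Cartan inclusion has the ideal intersection property. -/
theorem iip_total {D : Set A} (hD : IsPseudoCartan D) :
    IdealIntersectionProperty Set.univ D := by
  intro J hJ hne
  obtain ⟨y, hy, hy0⟩ := hD.iip_A J hJ hne
  have hJM : IsClosedIdealOf (RelComm D) (J ∩ RelComm D) :=
    { subset := Set.inter_subset_right
      zero_mem := ⟨hJ.zero_mem, by intro d _; simp⟩
      add_mem := fun u hu v hv => ⟨hJ.add_mem u hu.1 v hv.1, by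
        intro d hd; rw [add_mul, mul_add, hu.2 d hd, hv.2 d hd]⟩
      smul_mem := fun c u hu => ⟨hJ.smul_mem c u hu.1, by
        intro d hd; rw [smul_mul_assoc, mul_smul_comm, hu.2 d hd]⟩
      mul_left := fun c hc u hu => ⟨hJ.mul_left c trivial u hu.1, relComm_mul hc hu.2⟩
      mul_right := fun u hu c hc => ⟨hJ.mul_right u hu.1 c trivial, relComm_mul hu.2 hc⟩
      isClosed := hJ.isClosed.inter (relComm_isClosed D) }
  obtain ⟨z, hz, hz0⟩ := hD.iip_relComm _ hJM ⟨y, hy, hy0⟩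
  exact ⟨z, ⟨hz.1.1, hz.2⟩, hz0⟩

theorem inter_ideal {D I : Set A} (hD : IsPseudoCartan D)
    (hI : IsClosedIdealOf Set.univ I) : IsClosedIdealOf D (I ∩ D) where
  subset := Set.inter_subset_right
  zero_mem := ⟨hI.zero_mem, hD.inclusion.zero_mem⟩
  add_mem u hu v hv := ⟨hI.add_mem u hu.1 v hv.1, hD.inclusion.add_mem u hu.2 v hv.2⟩
  smul_mem c u hu := ⟨hI.smul_mem c u hu.1, hD.inclusion.smul_mem c u hu.2⟩
  mul_left c hc u hu := ⟨hI.mul_left c trivial u hu.1, hD.inclusion.mul_mem c hc u hu.2⟩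
  mul_right u hu c hc := ⟨hI.mul_right u hu.1 c trivial, hD.inclusion.mul_mem u hu.2 c hc⟩
  isClosed := hI.isClosed.inter hD.inclusion.isClosed

theorem inter_invariant {D I : Set A}
    (hI : IsClosedIdealOf Set.univ I) : IsInvariantIdeal D (I ∩ D) := fun n hn x hx =>
  ⟨hI.mul_right _ (hI.mul_left n trivial x hx.1) _ trivial, hn.1 x hx.2⟩

/-- For a closed ideal `I` of `A`, the annihilators of `I ∩ D` and of `I` agree. -/
theorem ann_inter {D I : Set A} (hD : IsPseudoCartan D)
    (hI : IsClosedIdealOf Set.univ I) : Ann Set.univ (I ∩ D) = Ann Set.univ I := by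
  have hL := ann_invariant hD (inter_ideal hD hI) (inter_invariant hI)
  have hLI : IsClosedIdealOf Set.univ (Ann Set.univ (I ∩ D) ∩ I) :=
    { subset := Set.subset_univ _
      zero_mem := ⟨hL.zero_mem, hI.zero_mem⟩
      add_mem := fun u hu v hv => ⟨hL.add_mem u hu.1 v hv.1, hI.add_mem u hu.2 v hv.2⟩
      smul_mem := fun c u hu => ⟨hL.smul_mem c u hu.1, hI.smul_mem c u hu.2⟩
      mul_left := fun c hc u hu => ⟨hL.mul_left c hc u hu.1, hI.mul_left c hc u hu.2⟩
      mul_right := fun u hu c hc => ⟨hL.mul_right u hu.1 c hc, hI.mul_right u hu.2 c hc⟩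
      isClosed := hL.isClosed.inter hI.isClosed }
  have hzero : ∀ z ∈ Ann Set.univ (I ∩ D) ∩ I, z = 0 := by
    intro z hz
    by_contra hz0
    obtain ⟨y, hy, hy0⟩ := iip_total hD _ hLI ⟨z, hz, hz0⟩
    apply hy0
    have hmem : star y * y ∈ I ∩ D :=
      (inter_ideal hD hI).mul_left _ (hD.inclusion.star_mem y hy.2) y ⟨hy.1.2, hy.2⟩
    have h := ((mem_ann_univ.1 hy.1.1) _ hmem).1
    rw [← CStarRing.star_mul_self_eq_zero_iff, ← CStarRing.star_mul_self_eq_zero_iff]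
    calc star (star y * y) * (star y * y) = star y * (y * (star y * y)) := by
          simp only [star_mul, star_star, mul_assoc]
      _ = 0 := by rw [h, mul_zero]
  ext c
  refine ⟨fun hc => mem_ann_univ.2 fun i hi => ⟨?_, ?_⟩,
    fun hc => mem_ann_univ.2 fun i hi => mem_ann_univ.1 hc i hi.1⟩
  · exact hzero _ ⟨hL.mul_right c hc i trivial, hI.mul_left c trivial i hi⟩
  · exact hzero _ ⟨hL.mul_left i trivial c hc, hI.mul_right i hi c trivial⟩

theorem ann_D (D X : Set A) : Ann D X = Ann Set.univ X ∩ D := by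
  ext c; simp [Ann, and_comm]

theorem ann_antitone {X Y : Set A} (h : X ⊆ Y) : Ann Set.univ Y ⊆ Ann Set.univ X :=
  fun _ hc => mem_ann_univ.2 fun x hx => mem_ann_univ.1 hc x (h hx)

theorem subset_ann_ann (X : Set A) : X ⊆ Ann Set.univ (Ann Set.univ X) :=
  fun x hx => mem_ann_univ.2 fun _ hc =>
    ⟨(mem_ann_univ.1 hc x hx).2, (mem_ann_univ.1 hc x hx).1⟩

theorem ann_ann_ann (X : Set A) :
    Ann Set.univ (Ann Set.univ (Ann Set.univ X)) = Ann Set.univ X :=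
  (ann_antitone (subset_ann_ann X)).antisymm (subset_ann_ann _)

end Helpers

/-- Let `(A,D)` be a pseudo-Cartan inclusion.  Then `J ↦ J ∩ D` is an
inclusion-preserving bijection from the regular ideals of `A` onto the invariant regular
ideals of `D`, with inverse `K ↦ K^{⊥⊥}` (annihilators computed in `A`). -/
theorem regular_ideal_lattice_iso
    {A : Type*} [NonUnitalCStarAlgebra A] [PartialOrder A] [StarOrderedRing A]
    (D : Set A) (hD : IsPseudoCartan D) :
    Set.BijOn (fun J => J ∩ D) {J : Set A | IsRegularIdealOf (Set.univ : Set A) J}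
      {K : Set A | IsInvariantRegularIdeal D K} ∧
    (∀ J : Set A, IsRegularIdealOf (Set.univ : Set A) J →
      Ann Set.univ (Ann Set.univ (J ∩ D)) = J) ∧
    (∀ K : Set A, IsInvariantRegularIdeal D K →
      Ann Set.univ (Ann Set.univ K) ∩ D = K) ∧
    (∀ J J' : Set A, IsRegularIdealOf (Set.univ : Set A) J →
      IsRegularIdealOf (Set.univ : Set A) J' → J ⊆ J' → J ∩ D ⊆ J' ∩ D) := by
  have h2 : ∀ J : Set A, IsRegularIdealOf (Set.univ : Set A) J →
      Ann Set.univ (Ann Set.univ (J ∩ D)) = J := by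
    intro J hJ
    rw [ann_inter hD hJ.1, hJ.2]
  have h3 : ∀ K : Set A, IsInvariantRegularIdeal D K →
      Ann Set.univ (Ann Set.univ K) ∩ D = K := by
    intro K hK
    have hI := ann_invariant hD hK.1.1 hK.2
    rw [← ann_inter hD hI, ← ann_D, ← ann_D]
    exact hK.1.2
  refine ⟨⟨?_, ?_, ?_⟩, h2, h3, fun J J' _ _ h => Set.inter_subset_inter_left D h⟩
  · intro J hJ
    refine ⟨⟨inter_ideal hD hJ.1, ?_⟩, inter_invariant hJ.1⟩
    change Ann D (Ann D (J ∩ D)) = J ∩ D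
    rw [ann_D D (J ∩ D), ann_D D, ann_inter hD hJ.1, ann_inter hD (ann_ideal hJ.1), hJ.2]
  · intro J hJ J' hJ' h
    have h' : J ∩ D = J' ∩ D := h
    rw [← h2 J hJ, ← h2 J' hJ', h']
  · intro K hK
    exact ⟨Ann Set.univ (Ann Set.univ K),
      ⟨ann_ideal (ann_invariant hD hK.1.1 hK.2), ann_ann_ann _⟩, h3 K hK⟩
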